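/- Let R be an integral domain, S a commutative R-algebra that is an integral domain containing R, and let B and P be R-subalgebras of S such that P is R-isomorphic to a polynomial algebra over R (in a possibly infinite set of variables). Assume that whenever b_1,…,b_m ∈ B are linearly dependent over P (there exist p_1,…,p_m ∈ P, not all zero, with Σ_i b_i p_i = 0 in S), they are linearly dependent over R. Then the R-algebra homomorphism B ⊗_R P → S induced by multiplication is injective. -/

import Mathlib

open TensorProduct in
/-- If scalar multiplication by `r` is injective on `M` and `N` is flat, then multiplication by `r`
has trivial kernel on `M ⊗ N`. -/
theorem smul_tensorProduct_eq_zero_of_flat {R M N : Type*} [CommRing R] [AddCommGroup M]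
    [AddCommGroup N] [Module R M] [Module R N] [Module.Flat R N] {r : R}
    (hr : Function.Injective fun m : M => r • m) {t : M ⊗[R] N} (ht : r • t = 0) : t = 0 := by
  have hinj := Module.Flat.rTensor_preserves_injective_linearMap (M := N)
    (LinearMap.lsmul R M r) hr
  refine hinj ?_
  have hsmul : LinearMap.lsmul R M r = r • LinearMap.id := rfl
  rw [map_zero, hsmul, LinearMap.rTensor_smul, LinearMap.rTensor_id]
  exact ht

open TensorProduct in
/-- A sum of `n` pure tensors lying in the kernel of the multiplication map vanishes, provided that
linear dependence over `P` descends to `R` and `B ⊗ P` is torsion-free over `R`. -/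
theorem sum_tmul_eq_zero_of_linear_dependence_descends
    {R S : Type*} [CommRing R] [CommRing S] [Algebra R S] (B P : Subalgebra R S)
    (htf : ∀ (r : R) (t : B ⊗[R] P), r ≠ 0 → r • t = 0 → t = 0)
    (hdep : ∀ (N : ℕ) (b p : Fin N → S),
      (∀ i, b i ∈ B) → (∀ i, p i ∈ P) → (∃ i, p i ≠ 0) → (∑ i, b i * p i = 0) →
      ∃ r : Fin N → R, (∃ i, r i ≠ 0) ∧ ∑ i, algebraMap R S (r i) * b i = 0)
    (n : ℕ) (b : Fin n → B) (p : Fin n → P) (h : ∑ i, (b i : S) * (p i : S) = 0) :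
    ∑ i, b i ⊗ₜ[R] p i = 0 := by
  induction n with
  | zero => simp
  | succ n ih =>
    by_cases hp : ∃ i, (p i : S) ≠ 0
    · obtain ⟨r, ⟨j, hj⟩, hr⟩ := hdep _ (fun i => b i) (fun i => p i)
        (fun i => (b i).2) (fun i => (p i).2) hp h
      have hrB : ∑ i, r i • b i = 0 := by
        apply Subtype.ext
        simpa [Algebra.smul_def] using hr
      have hrS : ∑ i, r i • (b i : S) = 0 := by
        simpa [Algebra.smul_def] using hr
      refine htf (r j) _ hj ?_
      have heq : r j • ∑ i, b i ⊗ₜ[R] p i = ∑ i, b i ⊗ₜ[R] (r j • p i - r i • p j) := by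
        simp only [tmul_sub, Finset.sum_sub_distrib, tmul_smul, Finset.smul_sum]
        simp only [smul_tmul', ← sum_tmul, hrB, zero_tmul, sub_zero]
      have hmul : ∑ i, (b i : S) * ((r j • p i - r i • p j : P) : S) = 0 := by
        calc ∑ i, (b i : S) * ((r j • p i - r i • p j : P) : S)
            = r j • ∑ i, (b i : S) * (p i : S) - (∑ i, r i • (b i : S)) * p j := by
              simp [mul_sub, Finset.smul_sum, Finset.sum_mul]
          _ = 0 := by simp [h, hrS]
      rw [Fin.sum_univ_succAbove _ j] at hmul
      rw [heq, Fin.sum_univ_succAbove _ j, sub_self, tmul_zero, zero_add]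
      refine ih _ _ ?_
      simpa using hmul
    · push Not at hp
      refine Finset.sum_eq_zero fun i _ => ?_
      rw [show p i = 0 from Subtype.ext (hp i), tmul_zero]

/-- **Injectivity of the multiplication map `B ⊗_R P → S`.**
Let `R` be an integral domain, `S` a commutative `R`-algebra which is an integral
domain containing `R` (the structure map `R → S` is injective), and let `B` and `P` be
`R`-subalgebras of `S` such that `P` is `R`-isomorphic to a polynomial algebra over
`R` (in a possibly infinite set of variables).  Assume that whenever `b₁, …, b_N ∈ B`
are linearly dependent over `P` (there are `p₁, …, p_N ∈ P`, not all zero, with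
`Σᵢ bᵢ pᵢ = 0` in `S`), they are linearly dependent over `R`.  Then the `R`-algebra
homomorphism `B ⊗_R P → S` induced by multiplication is injective. -/
theorem mulMap_injective_of_linear_dependence_descends
    {R S : Type} [CommRing R] [IsDomain R] [CommRing S] [IsDomain S] [Algebra R S]
    (hRS : Function.Injective (algebraMap R S))
    (B P : Subalgebra R S)
    (hP : ∃ ι : Type, Nonempty (MvPolynomial ι R ≃ₐ[R] ↥P))
    (hdep : ∀ (N : ℕ) (b p : Fin N → S),
      (∀ i, b i ∈ B) → (∀ i, p i ∈ P) → (∃ i, p i ≠ 0) → (∑ i, b i * p i = 0) →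
      ∃ r : Fin N → R, (∃ i, r i ≠ 0) ∧ ∑ i, algebraMap R S (r i) * b i = 0) :
    Function.Injective (Algebra.TensorProduct.productMap B.val P.val) := by
  obtain ⟨ι, ⟨e⟩⟩ := hP
  have : Module.Free R P := Module.Free.of_equiv e.toLinearEquiv
  rw [injective_iff_map_eq_zero]
  intro t ht
  obtain ⟨n, b, p, rfl⟩ := TensorProduct.exists_sum_tmul_eq t
  refine sum_tmul_eq_zero_of_linear_dependence_descends B P (fun r t hr hrt => ?_) hdep n b p ?_
  · refine smul_tensorProduct_eq_zero_of_flat (fun x y hxy => Subtype.ext ?_) hrt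
    have hxy' : r • (x : S) = r • (y : S) := congrArg Subtype.val hxy
    rw [Algebra.smul_def, Algebra.smul_def] at hxy'
    exact mul_left_cancel₀ ((map_ne_zero_iff _ hRS).mpr hr) hxy'
  · simpa using ht
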